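/- arXiv:1111.6422 — 2 statements merged into one kernel-verified Lean document; each statement's English description precedes it below -/
import Mathlib

section
/- Let k ≥ 1, r = 2k, and 0 ≤ m ≤ k. Then in ℚ[[q]]: Σ_{λ_1 ≥ … ≥ λ_r ≥ 0} (q^{Σ_{i=1}^r λ_i(λ_i+1)/2} / (q)_λ) · (1 + Σ_{i=0}^{m−1} q^{Σ_{j=0}^{i} (λ_{r−1−2j} + 1)}) = Σ_{μ_1 ≥ … ≥ μ_k ≥ 0} ((−q)_{μ_1} · q^{μ_1(μ_1+1)/2 + Σ_{i=2}^k (μ_i² + μ_i)} / (q)_μ) · (1 + Σ_{i=0}^{m−1} q^{Σ_{j=0}^{i} (μ_{k−j} + 1)}). -/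
open PowerSeries

noncomputable section

/-- The product (coefficientwise) topology on `ℚ⟦X⟧`. -/
instance : TopologicalSpace ℚ⟦X⟧ :=
  inferInstanceAs (TopologicalSpace ((Unit →₀ ℕ) → ℚ))

/-- `(q)_n = ∏_{i=1}^n (1 - q^i)` in `ℚ⟦X⟧`. -/
def qp (n : ℕ) : ℚ⟦X⟧ := ∏ i ∈ Finset.range n, (1 - X ^ (i + 1))

/-- `(-q)_n = ∏_{i=1}^n (1 + q^i)` in `ℚ⟦X⟧`. -/
def nqp (n : ℕ) : ℚ⟦X⟧ := ∏ i ∈ Finset.range n, (1 + X ^ (i + 1))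

/-- The Gaussian binomial `[M, N]_q`, zero unless `M ≥ N`. -/
def qbinom (M N : ℕ) : ℚ⟦X⟧ :=
  if N ≤ M then qp M * ((qp N)⁻¹ * (qp (M - N))⁻¹) else 0

/-- Weakly decreasing tuples `f 0 ≥ f 1 ≥ … ≥ f (r-1) ≥ 0`, encoded as
antitone functions `ℕ → ℕ` vanishing from index `r` on. -/
def DecTuple (r : ℕ) : Type :=
  {f : ℕ → ℕ // (∀ ⦃i j : ℕ⦄, i ≤ j → f j ≤ f i) ∧ ∀ i, r ≤ i → f i = 0}

/-- `(q)_λ = (q)_{λ_1-λ_2} ⋯ (q)_{λ_{r-1}-λ_r} (q)_{λ_r}` for a weakly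
decreasing tuple `λ` (0-indexed). -/
def qpT (r : ℕ) (f : ℕ → ℕ) : ℚ⟦X⟧ := ∏ i ∈ Finset.range r, qp (f i - f (i + 1))

lemma constantCoeff_qp (n : ℕ) : constantCoeff (qp n) = 1 := by
  simp [qp, map_prod]

lemma constantCoeff_nqp (n : ℕ) : constantCoeff (nqp n) = 1 := by
  simp [nqp, map_prod]

lemma nqp_mul_inv (n : ℕ) : nqp n * (nqp n)⁻¹ = 1 :=
  PowerSeries.mul_inv_cancel _ (by simp [constantCoeff_nqp])

lemma qp_mul_inv (n : ℕ) : qp n * (qp n)⁻¹ = 1 :=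
  PowerSeries.mul_inv_cancel _ (by simp [constantCoeff_qp])

lemma qp_succ (n : ℕ) : qp (n + 1) = qp n * (1 - X ^ (n + 1)) := by
  simp [qp, Finset.prod_range_succ]

lemma inv_qp_eq (n : ℕ) : (qp n)⁻¹ = (1 - X ^ (n + 1)) * (qp (n + 1))⁻¹ := by
  have h₁ := qp_mul_inv n
  have h₂ := qp_mul_inv (n + 1)
  rw [qp_succ] at h₂ ⊢
  linear_combination (-(qp n)⁻¹) * h₂ +
    (1 - X ^ (n + 1)) * (qp n * (1 - X ^ (n + 1)))⁻¹ * h₁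

lemma tri_succ (j : ℕ) : (j + 1) * (j + 1 + 1) / 2 = j * (j + 1) / 2 + (j + 1) := by
  rw [show (j + 1) * (j + 1 + 1) = j * (j + 1) + (j + 1) * 2 by ring,
    Nat.add_mul_div_right _ _ two_pos]

lemma two_mul_tri (j : ℕ) : 2 * (j * (j + 1) / 2) = j ^ 2 + j := by
  rw [Nat.mul_div_cancel' (Nat.even_mul_succ_self j).two_dvd]
  ring

/-- The finite `q`-binomial theorem. -/
lemma qbinomial_theorem (z : ℚ⟦X⟧) (n : ℕ) :
    ∑ j ∈ Finset.range (n + 1),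
        z ^ j * X ^ (j * (j + 1) / 2) * ((qp (n - j))⁻¹ * (qp j)⁻¹) =
      (∏ i ∈ Finset.range n, (1 + z * X ^ (i + 1))) * (qp n)⁻¹ := by
  induction n with
  | zero => simp [qp]
  | succ n ih =>
    have hz : (1 - X ^ (n + 1) : ℚ⟦X⟧) ≠ 0 := by
      intro h
      have := congrArg constantCoeff h
      simp at this
    apply mul_left_cancel₀ hz
    have hterm : ∀ j ∈ Finset.range (n + 1 + 1),
        (1 - X ^ (n + 1) : ℚ⟦X⟧) *
          (z ^ j * X ^ (j * (j + 1) / 2) * ((qp (n + 1 - j))⁻¹ * (qp j)⁻¹)) =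
        z ^ j * X ^ (j * (j + 1) / 2) * ((1 - X ^ (n + 1 - j)) * (qp (n + 1 - j))⁻¹ * (qp j)⁻¹)
        + z ^ j * X ^ (j * (j + 1) / 2) * X ^ (n + 1 - j) *
          ((qp (n + 1 - j))⁻¹ * ((1 - X ^ j) * (qp j)⁻¹)) := by
      intro j hj
      have hj : n + 1 = n + 1 - j + j := by have := Finset.mem_range.1 hj; omega
      have hX : (X : ℚ⟦X⟧) ^ (n + 1) = X ^ (n + 1 - j) * X ^ j := by
        rw [← pow_add, ← hj]
      rw [hX]
      ring
    rw [Finset.mul_sum, Finset.sum_congr rfl hterm, Finset.sum_add_distrib,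
      Finset.sum_range_succ, Finset.sum_range_succ' (n := n + 1)]
    have h₁ : ∀ j ∈ Finset.range (n + 1),
        z ^ j * X ^ (j * (j + 1) / 2) *
          ((1 - X ^ (n + 1 - j)) * (qp (n + 1 - j))⁻¹ * (qp j)⁻¹) =
        z ^ j * X ^ (j * (j + 1) / 2) * ((qp (n - j))⁻¹ * (qp j)⁻¹) := by
      intro j hj
      have hj : n + 1 - j = n - j + 1 := by have := Finset.mem_range.1 hj; omega
      rw [inv_qp_eq (n - j), hj]
    have h₂ : ∀ j ∈ Finset.range (n + 1),
        z ^ (j + 1) * X ^ ((j + 1) * (j + 1 + 1) / 2) * X ^ (n + 1 - (j + 1)) *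
          ((qp (n + 1 - (j + 1)))⁻¹ * ((1 - X ^ (j + 1)) * (qp (j + 1))⁻¹)) =
        z * X ^ (n + 1) *
          (z ^ j * X ^ (j * (j + 1) / 2) * ((qp (n - j))⁻¹ * (qp j)⁻¹)) := by
      intro j hj
      have hj : n + 1 = j + 1 + (n - j) := by have := Finset.mem_range.1 hj; omega
      have hX : (X : ℚ⟦X⟧) ^ (n + 1) = X ^ (j + 1) * X ^ (n - j) := by
        rw [← pow_add, ← hj]
      rw [← inv_qp_eq j, Nat.add_sub_add_right, tri_succ, hX, pow_add]
      ring
    rw [Finset.sum_congr rfl h₁, Finset.sum_congr rfl h₂, ← Finset.mul_sum, ih,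
      Finset.prod_range_succ, inv_qp_eq n]
    simp
    ring

lemma nqp_add (a n : ℕ) :
    nqp (a + n) = nqp a * ∏ i ∈ Finset.range n, (1 + X ^ a * X ^ (i + 1)) := by
  simp only [nqp, Finset.prod_range_add, ← pow_add, add_assoc]

lemma tri_add (a j : ℕ) :
    (a + j) * (a + j + 1) / 2 = a * (a + 1) / 2 + a * j + j * (j + 1) / 2 := by
  have h₁ := two_mul_tri (a + j)
  have h₂ := two_mul_tri a
  have h₃ := two_mul_tri j
  nlinarith

/-- Summing out a part `l` of a tuple that lies between its neighbours `a ≤ b`. -/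
lemma sum_Icc_eq {a b : ℕ} (hab : a ≤ b) :
    ∑ l ∈ Finset.Icc a b, X ^ (l * (l + 1) / 2) * ((qp (b - l))⁻¹ * (qp (l - a))⁻¹) =
      X ^ (a * (a + 1) / 2) * (nqp b * (nqp a)⁻¹) * (qp (b - a))⁻¹ := by
  obtain ⟨n, rfl⟩ := Nat.exists_eq_add_of_le hab
  have hIcc : Finset.Icc a (a + n) = (Finset.range (n + 1)).map (addLeftEmbedding a) := by
    rw [Finset.range_eq_Ico, Finset.map_add_left_Ico]
    ext l
    simp only [Finset.mem_Icc, Finset.mem_Ico]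
    omega
  have hterm : ∀ j ∈ Finset.range (n + 1),
      (X : ℚ⟦X⟧) ^ ((a + j) * (a + j + 1) / 2) *
        ((qp (a + n - (a + j)))⁻¹ * (qp (a + j - a))⁻¹) =
      X ^ (a * (a + 1) / 2) *
        ((X ^ a) ^ j * X ^ (j * (j + 1) / 2) * ((qp (n - j))⁻¹ * (qp j)⁻¹)) := by
    intro j _
    rw [tri_add, Nat.add_sub_add_left, Nat.add_sub_cancel_left, pow_add, pow_add, pow_mul]
    ring
  rw [hIcc, Finset.sum_map]
  simp only [addLeftEmbedding_apply]
  rw [Finset.sum_congr rfl hterm, ← Finset.mul_sum, qbinomial_theorem, nqp_add,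
    Nat.add_sub_cancel_left]
  linear_combination (-(X ^ (a * (a + 1) / 2) *
    (∏ i ∈ Finset.range n, (1 + X ^ a * X ^ (i + 1))) * (qp n)⁻¹)) * nqp_mul_inv a

lemma inv_qpT (r : ℕ) (f : ℕ → ℕ) :
    (qpT r f)⁻¹ = ∏ i ∈ Finset.range r, (qp (f i - f (i + 1)))⁻¹ := by
  induction r with
  | zero => simp [qpT]
  | succ r ih =>
    rw [qpT, Finset.prod_range_succ, PowerSeries.mul_inv_rev, ← qpT, ih,
      Finset.prod_range_succ, mul_comm]

lemma prod_range_two_mul {M : Type*} [CommMonoid M] (F : ℕ → M) (k : ℕ) :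
    ∏ i ∈ Finset.range (2 * k), F i = ∏ i ∈ Finset.range k, (F (2 * i) * F (2 * i + 1)) := by
  induction k with
  | zero => simp
  | succ k ih =>
    rw [Nat.mul_succ, Finset.prod_range_succ, Finset.prod_range_succ, ih,
      Finset.prod_range_succ, mul_assoc]

namespace DecTuple

/-- The sequence with even-indexed entries `g` and odd-indexed entries `p`. -/
def interleaveFun {k : ℕ} (g : ℕ → ℕ) (p : Fin k → ℕ) (n : ℕ) : ℕ :=
  if n % 2 = 0 then g (n / 2) else if h : n / 2 < k then p ⟨n / 2, h⟩ else 0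

lemma interleaveFun_even {k : ℕ} (g : ℕ → ℕ) (p : Fin k → ℕ) (i : ℕ) :
    interleaveFun g p (2 * i) = g i := by
  simp [interleaveFun]

lemma interleaveFun_odd {k : ℕ} (g : ℕ → ℕ) (p : Fin k → ℕ) (i : Fin k) :
    interleaveFun g p (2 * i + 1) = p i := by
  have h : (2 * (i : ℕ) + 1) / 2 = i := by omega
  simp [interleaveFun, h, Nat.add_mod]

/-- The possible odd-indexed entries of a tuple with even-indexed entries `g`. -/
abbrev Between (k : ℕ) (g : ℕ → ℕ) : Type :=
  (i : Fin k) → {l : ℕ // l ∈ Finset.Icc (g (i + 1)) (g i)}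

/-- The tuple with even-indexed entries `g` and odd-indexed entries `p`. -/
def interleave {k : ℕ} (g : DecTuple k) (p : Between k g.1) : DecTuple (2 * k) :=
  ⟨interleaveFun g.1 fun i => (p i : ℕ), by
    refine fun i j hij => antitone_nat_of_succ_le (fun n => ?_) hij
    obtain ⟨i, rfl | rfl⟩ := Nat.even_or_odd' n
    · rw [interleaveFun_even]
      by_cases hi : i < k
      · rw [interleaveFun_odd g.1 (fun i => (p i : ℕ)) ⟨i, hi⟩]
        exact (Finset.mem_Icc.1 (p ⟨i, hi⟩).2).2
      · have h : (2 * i + 1) / 2 = i := by omega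
        simp [interleaveFun, h, hi, Nat.add_mod]
    · rw [show 2 * i + 1 + 1 = 2 * (i + 1) by ring, interleaveFun_even]
      by_cases hi : i < k
      · rw [interleaveFun_odd g.1 (fun i => (p i : ℕ)) ⟨i, hi⟩]
        exact (Finset.mem_Icc.1 (p ⟨i, hi⟩).2).1
      · rw [g.2.2 (i + 1) (by omega)]
        exact Nat.zero_le _, by
    intro n hn
    have h : ¬ n / 2 < k := by omega
    simp [interleaveFun, h, g.2.2 (n / 2) (by omega)]⟩

lemma interleave_even {k : ℕ} (g : DecTuple k) (p : Between k g.1) (i : ℕ) :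
    (g.interleave p).1 (2 * i) = g.1 i :=
  interleaveFun_even g.1 (fun i => (p i : ℕ)) i

lemma interleave_odd {k : ℕ} (g : DecTuple k) (p : Between k g.1) (i : Fin k) :
    (g.interleave p).1 (2 * i + 1) = p i :=
  interleaveFun_odd g.1 (fun i => (p i : ℕ)) i

/-- A tuple of even length amounts to its even-indexed entries together with interlacing
odd-indexed ones. -/
def interleaveEquiv (k : ℕ) : (Σ g : DecTuple k, Between k g.1) ≃ DecTuple (2 * k) where
  toFun x := interleave x.1 x.2
  invFun f :=
    ⟨⟨fun i => f.1 (2 * i), fun _ _ h => f.2.1 (by omega), fun _ h => f.2.2 _ (by omega)⟩,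
      fun i => ⟨f.1 (2 * i + 1),
        Finset.mem_Icc.2 ⟨f.2.1 (by omega), f.2.1 (by omega)⟩⟩⟩
  left_inv := by
    rintro ⟨g, p⟩
    refine Sigma.ext (Subtype.ext (funext fun i => interleave_even g p i)) ?_
    refine Function.hfunext rfl ?_
    rintro i _ ⟨⟩
    refine (Subtype.heq_iff_coe_eq fun l => ?_).2 (interleave_odd g p i)
    simp only [interleave_even]
  right_inv := by
    rintro f
    refine Subtype.ext (funext fun n => ?_)
    obtain ⟨i, rfl | rfl⟩ := Nat.even_or_odd' n
    · exact interleave_even _ _ i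
    · by_cases hi : i < k
      · exact interleave_odd _ _ ⟨i, hi⟩
      · have h : (2 * i + 1) / 2 = i := by omega
        simp [interleave, interleaveFun, h, hi, Nat.add_mod, f.2.2 (2 * i + 1) (by omega)]

lemma finite_setOf_le (r n : ℕ) : {f : DecTuple r | ∀ i, f.1 i ≤ n}.Finite := by
  refine Set.Finite.of_finite_image
    (f := fun (f : DecTuple r) (i : Fin r) => f.1 i) ?_ ?_
  · refine (Set.finite_Iic (fun _ : Fin r => n)).subset ?_
    rintro _ ⟨f, hf, rfl⟩ i
    exact hf i
  · intro f _ g _ hfg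
    refine Subtype.ext (funext fun i => ?_)
    by_cases hi : i < r
    · exact congrFun hfg ⟨i, hi⟩
    · rw [f.2.2 i (by omega), g.2.2 i (by omega)]

end DecTuple

instance : T3Space ℚ⟦X⟧ := inferInstanceAs (T3Space ((Unit →₀ ℕ) → ℚ))

instance : ContinuousAdd ℚ⟦X⟧ := inferInstanceAs (ContinuousAdd ((Unit →₀ ℕ) → ℚ))

lemma summable_of_finite_support_coeff {ι : Type*} (F : ι → ℚ⟦X⟧)
    (hF : ∀ n, {i | coeff n (F i) ≠ 0}.Finite) : Summable F := by
  have h : ∀ d : Unit →₀ ℕ, Summable fun i => (F i : (Unit →₀ ℕ) → ℚ) d := by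
    intro d
    refine summable_of_hasFiniteSupport ((hF (d ())).subset fun i hi => ?_)
    rw [Set.mem_ofPred_eq, PowerSeries.coeff_def (s := d) rfl]
    exact hi
  exact Pi.summable.2 h

lemma summable_decTuple (r : ℕ) (W : DecTuple r → ℚ⟦X⟧) :
    Summable fun f : DecTuple r =>
      X ^ (∑ i ∈ Finset.range r, f.1 i * (f.1 i + 1) / 2) * W f := by
  refine summable_of_finite_support_coeff _ fun n =>
    (DecTuple.finite_setOf_le r n).subset fun f hf i => ?_
  by_cases hi : i < r
  · by_contra! h
    refine hf ?_
    rw [PowerSeries.coeff_X_pow_mul', if_neg]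
    have h₁ : f.1 i * (f.1 i + 1) / 2 ≤ ∑ i ∈ Finset.range r, f.1 i * (f.1 i + 1) / 2 :=
      Finset.single_le_sum (f := fun i => f.1 i * (f.1 i + 1) / 2)
        (fun _ _ => Nat.zero_le _) (Finset.mem_range.2 hi)
    have h₂ := two_mul_tri (f.1 i)
    nlinarith
  · rw [f.2.2 i (by omega)]
    exact Nat.zero_le _

/-- Summing out the odd-indexed entries of a tuple whose even-indexed entries are `g`. -/
lemma sum_between {k : ℕ} (hk : 1 ≤ k) (g : DecTuple k) :
    ∑ p : DecTuple.Between k g.1,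
        (X : ℚ⟦X⟧) ^ (∑ i ∈ Finset.range (2 * k),
          (g.interleave p).1 i * ((g.interleave p).1 i + 1) / 2) *
            (qpT (2 * k) (g.interleave p).1)⁻¹ =
      nqp (g.1 0) *
        (X : ℚ⟦X⟧) ^ (g.1 0 * (g.1 0 + 1) / 2 +
          ∑ i ∈ Finset.Ico 1 k, (g.1 i ^ 2 + g.1 i)) * (qpT k g.1)⁻¹ := by
  have hterm : ∀ p : DecTuple.Between k g.1,
      (X : ℚ⟦X⟧) ^ (∑ i ∈ Finset.range (2 * k),
          (g.interleave p).1 i * ((g.interleave p).1 i + 1) / 2) *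
            (qpT (2 * k) (g.interleave p).1)⁻¹ =
      ∏ i : Fin k, X ^ (g.1 i * (g.1 i + 1) / 2) * (X ^ ((p i : ℕ) * ((p i : ℕ) + 1) / 2) *
        ((qp (g.1 i - p i))⁻¹ * (qp (p i - g.1 (i + 1)))⁻¹)) := by
    intro p
    rw [inv_qpT, ← Finset.prod_pow_eq_pow_sum, ← Finset.prod_mul_distrib, prod_range_two_mul,
      Finset.prod_range]
    refine Finset.prod_congr rfl fun i _ => ?_
    have h₀ : (g.interleave p).1 (2 * i) = g.1 i := DecTuple.interleave_even _ _ _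
    have h₁ : (g.interleave p).1 (2 * i + 1) = p i := DecTuple.interleave_odd _ _ i
    have h₂ : (g.interleave p).1 (2 * i + 1 + 1) = g.1 (i + 1) :=
      DecTuple.interleave_even _ _ (i + 1)
    rw [h₀, h₁, h₂]
    ring
  have hnqp : ∀ n, ∏ i ∈ Finset.range n, (nqp (g.1 i) * (nqp (g.1 (i + 1)))⁻¹) =
      nqp (g.1 0) * (nqp (g.1 n))⁻¹ := by
    intro n
    induction n with
    | zero => simp [nqp_mul_inv]
    | succ n ih =>
      rw [Finset.prod_range_succ, ih]
      linear_combination nqp (g.1 0) * (nqp (g.1 (n + 1)))⁻¹ * nqp_mul_inv (g.1 n)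
  have hexp : ∑ i ∈ Finset.range k,
      (g.1 i * (g.1 i + 1) / 2 + g.1 (i + 1) * (g.1 (i + 1) + 1) / 2) =
      g.1 0 * (g.1 0 + 1) / 2 + ∑ i ∈ Finset.Ico 1 k, (g.1 i ^ 2 + g.1 i) := by
    obtain ⟨n, rfl⟩ := Nat.exists_eq_add_of_le' hk
    rw [Finset.sum_add_distrib, Finset.sum_range_succ', Finset.sum_range_succ (n := n),
      g.2.2 (n + 1) le_rfl, Finset.sum_Ico_eq_sum_range]
    simp only [← two_mul_tri, Nat.add_sub_cancel, add_comm 1, ← Finset.mul_sum]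
    omega
  rw [Finset.sum_congr rfl fun p _ => hterm p, ← Fintype.prod_sum
    (f := fun (i : Fin k) (l : {l : ℕ // l ∈ Finset.Icc (g.1 (i + 1)) (g.1 i)}) =>
      (X : ℚ⟦X⟧) ^ (g.1 i * (g.1 i + 1) / 2) * (X ^ ((l : ℕ) * ((l : ℕ) + 1) / 2) *
        ((qp (g.1 i - l))⁻¹ * (qp (l - g.1 (i + 1)))⁻¹)))]
  have hfactor : ∀ i : Fin k,
      ∑ l : {l : ℕ // l ∈ Finset.Icc (g.1 (i + 1)) (g.1 i)},
        (X : ℚ⟦X⟧) ^ (g.1 i * (g.1 i + 1) / 2) * (X ^ ((l : ℕ) * ((l : ℕ) + 1) / 2) *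
        ((qp (g.1 i - l))⁻¹ * (qp (l - g.1 (i + 1)))⁻¹)) =
      (nqp (g.1 i) * (nqp (g.1 (i + 1)))⁻¹) *
        X ^ (g.1 i * (g.1 i + 1) / 2 + g.1 (i + 1) * (g.1 (i + 1) + 1) / 2) *
        (qp (g.1 i - g.1 (i + 1)))⁻¹ := by
    intro i
    rw [← Finset.mul_sum, Finset.sum_coe_sort (Finset.Icc (g.1 (i + 1)) (g.1 i)) fun l =>
      (X : ℚ⟦X⟧) ^ (l * (l + 1) / 2) * ((qp (g.1 i - l))⁻¹ * (qp (l - g.1 (i + 1)))⁻¹),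
      sum_Icc_eq (g.2.1 (Nat.le_succ i)), pow_add]
    ring
  rw [Finset.prod_congr rfl fun i _ => hfactor i, ← Finset.prod_range fun i =>
    (nqp (g.1 i) * (nqp (g.1 (i + 1)))⁻¹) *
        (X : ℚ⟦X⟧) ^ (g.1 i * (g.1 i + 1) / 2 + g.1 (i + 1) * (g.1 (i + 1) + 1) / 2) *
        (qp (g.1 i - g.1 (i + 1)))⁻¹,
    Finset.prod_mul_distrib, Finset.prod_mul_distrib, hnqp, Finset.prod_pow_eq_pow_sum, hexp,
    ← inv_qpT, g.2.2 k le_rfl]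
  simp [nqp]

/-- Proposition for even rank `r = 2k`  (`f.1 t` is `λ_{t+1}`, `g.1 t` is `μ_{t+1}`). -/
theorem stmt11 (k m : ℕ) (hk : 1 ≤ k) (hm : m ≤ k) :
    (∑' f : DecTuple (2 * k),
        (X : ℚ⟦X⟧) ^ (∑ i ∈ Finset.range (2 * k), f.1 i * (f.1 i + 1) / 2) *
          (qpT (2 * k) f.1)⁻¹ *
          (1 + ∑ i ∈ Finset.range m,
            (X : ℚ⟦X⟧) ^ ∑ j ∈ Finset.range (i + 1), (f.1 (2 * k - 2 - 2 * j) + 1))) =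
      ∑' g : DecTuple k,
        nqp (g.1 0) *
            (X : ℚ⟦X⟧) ^ (g.1 0 * (g.1 0 + 1) / 2 +
              ∑ i ∈ Finset.Ico 1 k, (g.1 i ^ 2 + g.1 i)) *
            (qpT k g.1)⁻¹ *
          (1 + ∑ i ∈ Finset.range m,
            (X : ℚ⟦X⟧) ^ ∑ j ∈ Finset.range (i + 1), (g.1 (k - 1 - j) + 1)) := by
  have hsum : Summable fun f : DecTuple (2 * k) =>
      (X : ℚ⟦X⟧) ^ (∑ i ∈ Finset.range (2 * k), f.1 i * (f.1 i + 1) / 2) *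
        (qpT (2 * k) f.1)⁻¹ *
        (1 + ∑ i ∈ Finset.range m,
          (X : ℚ⟦X⟧) ^ ∑ j ∈ Finset.range (i + 1), (f.1 (2 * k - 2 - 2 * j) + 1)) := by
    simp only [mul_assoc]
    exact summable_decTuple (2 * k) _
  have hsigma := (DecTuple.interleaveEquiv k).summable_iff.2 hsum
  rw [← (DecTuple.interleaveEquiv k).tsum_eq]
  refine (hsigma.tsum_sigma' fun g => Summable.of_finite).trans (tsum_congr fun g => ?_)
  rw [tsum_fintype, ← sum_between hk g, Finset.sum_mul]
  refine Finset.sum_congr rfl fun p _ => ?_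
  have hodd : ∀ j, (g.interleave p).1 (2 * k - 2 - 2 * j) = g.1 (k - 1 - j) := by
    intro j
    rw [show 2 * k - 2 - 2 * j = 2 * (k - 1 - j) by omega]
    exact DecTuple.interleave_even _ _ _
  refine congrArg (HMul.hMul _) (congrArg (HAdd.hAdd 1) (Finset.sum_congr rfl fun i _ => ?_))
  exact congrArg ((X : ℚ⟦X⟧) ^ ·) (Finset.sum_congr rfl fun j _ => congrArg (· + 1) (hodd j))
end
end

section
/- Let k ≥ 1 and 1 ≤ s ≤ k. Then (1 − x_s) ∏_{i=s+1}^{k} x_i ≈₂ q^{s−1} (1 + q x_{k−s+1}) (∏_{i=1}^{k−s+1} x_i) (∏_{i=k−s+2}^{k} x_i²), where empty products equal 1. -/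
open PowerSeries

noncomputable section

/-- The variable `x_j` (1-indexed, `1 ≤ j ≤ r`) of `ℤ[x_1,…,x_r,q]`, with the
conventions `x_j = 0` for `j < 1` and `x_j = 1` for `j > r`. -/
def xv (r j : ℕ) : MvPolynomial (Fin (r + 1)) ℤ :=
  if h : 1 ≤ j ∧ j ≤ r then MvPolynomial.X ⟨j - 1, by omega⟩
  else if j = 0 then 0 else 1

/-- The variable `q` of `ℤ[x_1,…,x_r,q]`. -/
def qv (r : ℕ) : MvPolynomial (Fin (r + 1)) ℤ := MvPolynomial.X (Fin.last r)

/-- Evaluation of `P ∈ ℤ[x_1,…,x_r,q]` at `x_j = q^{λ_j}` and `q = X` in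
`ℚ⟦X⟧`; here `f` is the 0-indexed tuple `(λ_1, …, λ_r)`. -/
def pEval (r : ℕ) (f : ℕ → ℕ) (P : MvPolynomial (Fin (r + 1)) ℤ) : ℚ⟦X⟧ :=
  MvPolynomial.aeval
    (fun i : Fin (r + 1) => if (i : ℕ) < r then (X : ℚ⟦X⟧) ^ f i else X) P

/-- The relation `P ≈₂ Q`:
`Σ_{λ_1 ≥ … ≥ λ_k ≥ 0} (-q)_{λ_1} q^{λ_1(λ_1-1)/2 + Σ_{i=2}^k λ_i²}/(q)_λ ·
  (P(q^{λ_1},…,q^{λ_k},q) - Q(q^{λ_1},…,q^{λ_k},q)) = 0`. -/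
def papprox2 (k : ℕ) (P Q : MvPolynomial (Fin (k + 1)) ℤ) : Prop :=
  ∑' f : DecTuple k,
    nqp (f.1 0) *
        (X : ℚ⟦X⟧) ^ (f.1 0 * (f.1 0 - 1) / 2 + ∑ i ∈ Finset.Ico 1 k, f.1 i ^ 2) *
        (qpT k f.1)⁻¹ *
      (pEval k f.1 P - pEval k f.1 Q) = 0

instance : T2Space ℚ⟦X⟧ :=
  inferInstanceAs (T2Space ((Unit →₀ ℕ) → ℚ))

instance : IsTopologicalAddGroup ℚ⟦X⟧ :=
  inferInstanceAs (IsTopologicalAddGroup ((Unit →₀ ℕ) → ℚ))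

/-- The weight `(-q)_{λ_1} q^{λ_1(λ_1-1)/2 + Σ_{i=2}^k λ_i²}/(q)_λ` of a tuple. -/
def tupleWeight (k : ℕ) (f : ℕ → ℕ) : ℚ⟦X⟧ :=
  nqp (f 0) * (X : ℚ⟦X⟧) ^ (f 0 * (f 0 - 1) / 2 + ∑ i ∈ Finset.Ico 1 k, f i ^ 2) * (qpT k f)⁻¹

/-- The weighted sum of `F` over all weakly decreasing tuples. -/
def weightedSum (k : ℕ) (F : (ℕ → ℕ) → ℚ⟦X⟧) : ℚ⟦X⟧ :=
  ∑' f : DecTuple k, tupleWeight k f.1 * F f.1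

lemma finite_decTuple_head_le (k N : ℕ) : {f : DecTuple k | f.1 0 ≤ N}.Finite := by
  refine Set.Finite.of_injOn (f := fun f : DecTuple k => fun i : Fin k => f.1 i)
    (t := Set.Iic fun _ => N) ?_ ?_ (Set.finite_Iic _)
  · intro f hf i
    exact (f.2.1 (Nat.zero_le _)).trans hf
  · intro f _ g _ h
    apply Subtype.ext
    funext i
    by_cases hi : i < k
    · exact congrFun h ⟨i, hi⟩
    · rw [f.2.2 i (by omega), g.2.2 i (by omega)]

lemma summable_of_coeff_finite {ι : Type*} (F : ι → ℚ⟦X⟧)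
    (h : ∀ n : ℕ, {i | coeff n (F i) ≠ 0}.Finite) : Summable F := by
  refine (Pi.summable (X := fun _ : Unit →₀ ℕ => ℚ) (f := F)).2 fun d => ?_
  refine summable_of_hasFiniteSupport ((h (d ())).subset fun i hi => ?_)
  have hd : d = Finsupp.single () (d ()) := by ext; simp
  rw [Function.mem_support, hd] at hi
  exact hi

lemma summable_tupleWeight_mul (k : ℕ) (F : (ℕ → ℕ) → ℚ⟦X⟧) :
    Summable fun f : DecTuple k => tupleWeight k f.1 * F f.1 := by
  refine summable_of_coeff_finite _ fun n => (finite_decTuple_head_le k (n + 2)).subset ?_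
  intro f hf
  by_contra hlt
  refine hf ?_
  simp only [Set.mem_ofPred_eq, not_le] at hlt
  have hd : (X : ℚ⟦X⟧) ^ (n + 1) ∣ tupleWeight k f.1 * F f.1 := by
    refine Dvd.dvd.mul_right (Dvd.dvd.mul_right (Dvd.dvd.mul_left (pow_dvd_pow _ ?_) _) _) _
    refine le_trans ?_ (Nat.le_add_right _ _)
    rw [Nat.le_div_iff_mul_le two_pos]
    exact Nat.mul_le_mul (by omega) (by omega)
  exact X_pow_dvd_iff.1 hd n (Nat.lt_succ_self n)

lemma weightedSum_add (k : ℕ) (F G : (ℕ → ℕ) → ℚ⟦X⟧) :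
    weightedSum k (fun f => F f + G f) = weightedSum k F + weightedSum k G := by
  unfold weightedSum
  rw [← (summable_tupleWeight_mul k F).tsum_add (summable_tupleWeight_mul k G)]
  simp only [mul_add]

lemma weightedSum_sub (k : ℕ) (F G : (ℕ → ℕ) → ℚ⟦X⟧) :
    weightedSum k (fun f => F f - G f) = weightedSum k F - weightedSum k G := by
  unfold weightedSum
  rw [← (summable_tupleWeight_mul k F).tsum_sub (summable_tupleWeight_mul k G)]
  simp only [mul_sub]

lemma weightedSum_congr {k : ℕ} {F G : (ℕ → ℕ) → ℚ⟦X⟧} (h : ∀ f : DecTuple k, F f.1 = G f.1) :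
    weightedSum k F = weightedSum k G := by
  unfold weightedSum
  simp only [h]

lemma qp_ne_zero (n : ℕ) : constantCoeff (qp n) ≠ 0 := by
  simp [qp, map_prod]

lemma qpT_ne_zero (k : ℕ) (f : ℕ → ℕ) : constantCoeff (qpT k f) ≠ 0 := by
  rw [qpT, map_prod]
  exact Finset.prod_ne_zero_iff.2 fun i _ => qp_ne_zero _

/-- The extension of `q x_i` (1-indexed) to `i = 0`, where its value is `-1`. -/
def shiftedVar (f : ℕ → ℕ) : ℕ → ℚ⟦X⟧
  | 0 => -1
  | i + 1 => X * X ^ f i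

lemma inv_mul_eq_inv_mul {S T A B : ℚ⟦X⟧} (hS : constantCoeff S ≠ 0) (hT : constantCoeff T ≠ 0)
    (h : S * A = T * B) : S⁻¹ * B = T⁻¹ * A := by
  have h1 := PowerSeries.inv_mul_cancel S hS
  have h2 := PowerSeries.inv_mul_cancel T hT
  linear_combination (-(S⁻¹ * T⁻¹)) * h + (T⁻¹ * A) * h1 - (S⁻¹ * B) * h2

lemma qpT_update_zero {k : ℕ} (hk : 0 < k) {f : ℕ → ℕ} (hf : f 1 ≤ f 0) :
    qpT k (Function.update f 0 (f 0 + 1)) = qpT k f * (1 - X ^ (f 0 - f 1 + 1)) := by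
  unfold qpT
  rw [← Finset.mul_prod_erase _ _ (Finset.mem_range.2 hk),
    ← Finset.mul_prod_erase (Finset.range k) (fun i => qp (f i - f (i + 1))) (Finset.mem_range.2 hk)]
  have e : ∏ x ∈ (Finset.range k).erase 0, qp (Function.update f 0 (f 0 + 1) x -
      Function.update f 0 (f 0 + 1) (x + 1)) =
      ∏ x ∈ (Finset.range k).erase 0, qp (f x - f (x + 1)) := by
    refine Finset.prod_congr rfl fun x hx => ?_
    rw [Function.update_of_ne (Finset.ne_of_mem_erase hx), Function.update_of_ne (by omega)]
  rw [e, Function.update_self, Function.update_of_ne (by omega)]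
  have : f 0 + 1 - f (0 + 1) = f 0 - f 1 + 1 := by simp only [zero_add]; omega
  rw [this, qp_succ]
  ring

lemma qpT_update_succ {k i : ℕ} (hk : i + 1 < k) {f : ℕ → ℕ} (hf : f (i + 2) ≤ f (i + 1))
    (hlt : f (i + 1) < f i) :
    qpT k (Function.update f (i + 1) (f (i + 1) + 1)) * (1 - X ^ (f i - f (i + 1))) =
      qpT k f * (1 - X ^ (f (i + 1) - f (i + 2) + 1)) := by
  unfold qpT
  have m1 : i + 1 ∈ Finset.range k := Finset.mem_range.2 hk
  have m2 : i ∈ (Finset.range k).erase (i + 1) := by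
    simp only [Finset.mem_erase, Finset.mem_range]; omega
  rw [← Finset.mul_prod_erase _ _ m1, ← Finset.mul_prod_erase _ _ m2,
    ← Finset.mul_prod_erase (Finset.range k) (fun i => qp (f i - f (i + 1))) m1,
    ← Finset.mul_prod_erase _ (fun i => qp (f i - f (i + 1))) m2]
  have e : ∏ x ∈ ((Finset.range k).erase (i + 1)).erase i,
      qp (Function.update f (i + 1) (f (i + 1) + 1) x -
        Function.update f (i + 1) (f (i + 1) + 1) (x + 1)) =
      ∏ x ∈ ((Finset.range k).erase (i + 1)).erase i, qp (f x - f (x + 1)) := by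
    refine Finset.prod_congr rfl fun x hx => ?_
    simp only [Finset.mem_erase] at hx
    rw [Function.update_of_ne hx.2.1, Function.update_of_ne (by omega)]
  rw [e, Function.update_self, Function.update_of_ne (by omega), Function.update_of_ne (by omega)]
  obtain ⟨d, hd⟩ := Nat.exists_eq_add_of_lt hlt
  have h1 : f (i + 1) + 1 - f (i + 1 + 1) = f (i + 1) - f (i + 2) + 1 := by
    change _ - f (i + 2) = _; omega
  have h2 : f i - f (i + 1) = d + 1 := by omega
  have h3 : f i - (f (i + 1) + 1) = d := by omega
  have h4 : f (i + 1) - f (i + 1 + 1) = f (i + 1) - f (i + 2) := rfl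
  simp only [h1, h2, h3, h4, qp_succ]
  ring

lemma tupleWeight_update_zero {k : ℕ} (hk : 0 < k) {f : ℕ → ℕ} (hf : f 1 ≤ f 0) :
    tupleWeight k (Function.update f 0 (f 0 + 1)) * (X ^ f 1 - X ^ (f 0 + 1)) =
      tupleWeight k f * ((X * X ^ f 0 + 1) * X ^ f 0 * X ^ f 1) := by
  have hT := inv_mul_eq_inv_mul (A := 1) (qpT_ne_zero _ _) (qpT_ne_zero _ _)
    ((mul_one _).trans (qpT_update_zero hk hf))
  have hs : ∑ i ∈ Finset.Ico 1 k, Function.update f 0 (f 0 + 1) i ^ 2 =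
      ∑ i ∈ Finset.Ico 1 k, f i ^ 2 := by
    refine Finset.sum_congr rfl fun x hx => ?_
    rw [Function.update_of_ne (by simp at hx; omega)]
  have ht : (f 0 + 1) * (f 0 + 1 - 1) / 2 = f 0 * (f 0 - 1) / 2 + f 0 := by
    rw [← Nat.triangle_succ]
  have hn : nqp (f 0 + 1) = nqp (f 0) * (1 + X ^ (f 0 + 1)) := by
    rw [nqp, Finset.prod_range_succ, ← nqp]
  have hx : (X : ℚ⟦X⟧) ^ (f 0 + 1) = X ^ f 1 * X ^ (f 0 - f 1 + 1) := by
    rw [← pow_add]; congr 1; omega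
  unfold tupleWeight
  rw [hs, Function.update_self, ht, hn]
  linear_combination (nqp (f 0) * (1 + X ^ (f 0 + 1)) * X ^ (f 0 * (f 0 - 1) / 2) * X ^ f 0 *
    X ^ (∑ i ∈ Finset.Ico 1 k, f i ^ 2)) *
      (X ^ f 1 * hT - (qpT k (Function.update f 0 (f 0 + 1)))⁻¹ * hx)

lemma tupleWeight_update_succ {k i : ℕ} (hk : i + 1 < k) {f : ℕ → ℕ}
    (hf : f (i + 2) ≤ f (i + 1)) (hlt : f (i + 1) < f i) :
    tupleWeight k (Function.update f (i + 1) (f (i + 1) + 1)) *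
        (X ^ f (i + 2) - X ^ (f (i + 1) + 1)) =
      tupleWeight k f *
        ((X * X ^ f (i + 1) - X * X ^ f i) * X ^ f (i + 1) * X ^ f (i + 2)) := by
  have hT := inv_mul_eq_inv_mul (qpT_ne_zero _ _) (qpT_ne_zero _ _) (qpT_update_succ hk hf hlt)
  have m1 : i + 1 ∈ Finset.Ico 1 k := by simp; omega
  have hs : ∑ j ∈ Finset.Ico 1 k, Function.update f (i + 1) (f (i + 1) + 1) j ^ 2 =
      (∑ j ∈ Finset.Ico 1 k, f j ^ 2) + (f (i + 1) + f (i + 1) + 1) := by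
    rw [← Finset.add_sum_erase _ _ m1, ← Finset.add_sum_erase _ (fun j => f j ^ 2) m1]
    have e : ∑ x ∈ (Finset.Ico 1 k).erase (i + 1),
        Function.update f (i + 1) (f (i + 1) + 1) x ^ 2 =
        ∑ x ∈ (Finset.Ico 1 k).erase (i + 1), f x ^ 2 := by
      refine Finset.sum_congr rfl fun x hx => ?_
      rw [Function.update_of_ne (Finset.ne_of_mem_erase hx)]
    rw [e, Function.update_self]
    ring
  have hx : (X : ℚ⟦X⟧) ^ (f (i + 1) + 1) = X ^ f (i + 2) * X ^ (f (i + 1) - f (i + 2) + 1) := by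
    rw [← pow_add]; congr 1; omega
  have hy : (X : ℚ⟦X⟧) ^ f i = X ^ f (i + 1) * X ^ (f i - f (i + 1)) := by
    rw [← pow_add]; congr 1; omega
  unfold tupleWeight
  rw [hs, Function.update_of_ne (by omega), hx, hy]
  linear_combination (nqp (f 0) * X ^ (f 0 * (f 0 - 1) / 2) * X *
    X ^ (∑ i ∈ Finset.Ico 1 k, f i ^ 2) * X ^ f (i + 1) * X ^ f (i + 1) * X ^ f (i + 2)) * hT

/-- Shifting the single part `λ_{i+1}` by one in the weighted sum. -/
lemma weightedSum_shift {k i : ℕ} (hi : i < k) (Q : (ℕ → ℕ) → ℚ⟦X⟧)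
    (hQ : ∀ f n, Q (Function.update f i n) = Q f) :
    weightedSum k (fun f => (X ^ f (i + 1) - X ^ f i) * Q f) =
      weightedSum k (fun f => (shiftedVar f (i + 1) - shiftedVar f i) *
        X ^ f i * X ^ f (i + 1) * Q f) := by
  have hroom : ∀ f : ℕ → ℕ, Antitone f → shiftedVar f (i + 1) - shiftedVar f i ≠ 0 →
      ∀ j, j < i → f i < f j := by
    intro f hf hne j hj
    obtain ⟨i, rfl⟩ : ∃ m, i = m + 1 := ⟨i - 1, by omega⟩
    refine lt_of_lt_of_le ?_ (hf (show j ≤ i by omega))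
    refine lt_of_le_of_ne (hf (Nat.le_succ i)) fun h => hne ?_
    simp [shiftedVar, h]
  have hstep : ∀ f : ℕ → ℕ, Antitone f → (∀ j, j < i → f i < f j) →
      tupleWeight k (Function.update f i (f i + 1)) * (X ^ f (i + 1) - X ^ (f i + 1)) =
        tupleWeight k f *
          ((shiftedVar f (i + 1) - shiftedVar f i) * X ^ f i * X ^ f (i + 1)) := by
    intro f hf hr
    cases i with
    | zero =>
      rw [tupleWeight_update_zero hi (hf (Nat.le_succ 0))]
      simp [shiftedVar]
    | succ i =>
      exact tupleWeight_update_succ hi (hf (Nat.le_succ _)) (hr i (Nat.lt_succ_self i))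
  refine tsum_eq_tsum_of_ne_zero_bij
    (fun f => ⟨Function.update f.1.1 i (f.1.1 i + 1), ?_, ?_⟩) ?_ ?_ ?_
  · have hne : shiftedVar f.1.1 (i + 1) - shiftedVar f.1.1 i ≠ 0 := by
      intro h; apply f.2; simp [h]
    have hr := hroom _ f.1.2.1 hne
    intro a b hab
    have := f.1.2.1 hab
    simp only [Function.update_apply]
    split_ifs with h1 h2 h2
    · exact le_rfl
    · subst h1
      exact hr a (by omega)
    · subst h2; omega
    · exact this
  · intro j hj
    rw [Function.update_of_ne (by omega)]
    exact f.1.2.2 j hj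
  · intro f g h
    have h' := congrArg Subtype.val h
    apply Subtype.ext
    apply Subtype.ext
    funext j
    have hj := congrFun h' j
    simp only [Function.update_apply] at hj
    split_ifs at hj with h1
    · subst h1; omega
    · exact hj
  · intro f hf
    have hgt : f.1 (i + 1) < f.1 i := by
      refine lt_of_le_of_ne (f.2.1 (Nat.le_succ i)) fun h => hf ?_
      simp [h]
    have hup : Function.update (Function.update f.1 i (f.1 i - 1)) i
        (Function.update f.1 i (f.1 i - 1) i + 1) = f.1 := by
      funext j
      simp only [Function.update_apply]
      split_ifs with h1
      · subst h1; omega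
      · rfl
    have hdec : ∀ ⦃a b : ℕ⦄, a ≤ b → Function.update f.1 i (f.1 i - 1) b ≤
        Function.update f.1 i (f.1 i - 1) a := by
      intro a b hab
      have := f.2.1 hab
      simp only [Function.update_apply]
      split_ifs with h1 h2 h2
      · exact le_rfl
      · subst h1; omega
      · subst h2
        have := f.2.1 (show a + 1 ≤ b by omega)
        omega
      · exact this
    have hzero : ∀ j, k ≤ j → Function.update f.1 i (f.1 i - 1) j = 0 := by
      intro j hj
      rw [Function.update_of_ne (by omega)]
      exact f.2.2 j hj
    refine ⟨⟨⟨_, hdec, hzero⟩, fun h0 => hf ?_⟩, Subtype.ext hup⟩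
    have h1 := hstep _ hdec fun j hj => by
      rw [Function.update_self, Function.update_of_ne (by omega)]
      have := f.2.1 hj.le
      omega
    rw [hup, Function.update_self, Function.update_of_ne (Nat.succ_ne_self i),
      show f.1 i - 1 + 1 = f.1 i by omega] at h1
    simp only [hQ, Function.update_self, Function.update_of_ne (Nat.succ_ne_self i)] at h0
    linear_combination Q f.1 * h1 + h0
  · intro f
    have hne : shiftedVar f.1.1 (i + 1) - shiftedVar f.1.1 i ≠ 0 := by
      intro h; apply f.2; simp [h]
    have := hstep _ f.1.2.1 (hroom _ f.1.2.1 hne)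
    simp only [hQ, Function.update_self, Function.update_of_ne (Nat.succ_ne_self i)]
    linear_combination Q f.1.1 * this


/-- Shifting all the parts with index in `[a, b)` successively. -/
lemma weightedSum_shift_block {k a b : ℕ} (hab : a < b) (hb : b ≤ k) :
    ∀ R : (ℕ → ℕ) → ℚ⟦X⟧, (∀ i, a ≤ i → i < b → ∀ f n, R (Function.update f i n) = R f) →
    weightedSum k (fun f => (X ^ f b - X ^ f a) * (∏ j ∈ Finset.Ioo a b, X ^ f j) * R f) =
      weightedSum k (fun f => (shiftedVar f b - shiftedVar f a) *
        (∏ j ∈ Finset.Icc a b, X ^ f j) * R f) := by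
  induction b, (Nat.succ_le_of_lt hab) using Nat.le_induction with
  | base =>
    intro R hR
    have h := weightedSum_shift (k := k) (i := a) (by omega) R (hR a le_rfl hab)
    have h1 : Finset.Ioo a (a + 1) = ∅ :=
      Finset.eq_empty_of_forall_notMem fun j hj => by rw [Finset.mem_Ioo] at hj; omega
    have h2 : Finset.Icc a (a + 1) = {a, a + 1} := by ext; simp; omega
    simp only [Nat.succ_eq_add_one, h1, h2, Finset.prod_empty, mul_one]
    rw [h]
    refine weightedSum_congr fun f => ?_
    rw [Finset.prod_pair (by omega)]
    ring
  | succ b hle ih =>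
    intro R hR
    have hle' : a < b := hle
    have h1 := weightedSum_shift (k := k) (i := b) (by omega)
      (fun f => (∏ j ∈ Finset.Ico a b, X ^ f j) * R f) (by
        intro f n
        rw [hR b (by omega) (by omega)]
        congr 1
        refine Finset.prod_congr rfl fun j hj => ?_
        rw [Function.update_of_ne (by simp at hj; omega)])
    have h2 := ih hle' (by omega) (fun f => X ^ f (b + 1) * R f) (by
        intro i hi hib f n
        rw [hR i hi (by omega), Function.update_of_ne (by omega)])
    have e1 : Finset.Ioo a (b + 1) = insert b (Finset.Ioo a b) := by ext; simp; omega
    have e2 : Finset.Ico a b = insert a (Finset.Ioo a b) := by ext; simp; omega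
    have e3 : Finset.Icc a b = insert b (insert a (Finset.Ioo a b)) := by ext; simp; omega
    have e4 : Finset.Icc a (b + 1) = insert (b + 1) (Finset.Icc a b) := by ext; simp; omega
    have h := congrArg₂ (· + ·) h1 h2
    simp only [← weightedSum_add] at h
    rw [e4, e3, e1]
    rw [e3, e2] at h
    convert h using 3 with f f
    · rw [Finset.prod_insert (by simp), Finset.prod_insert (by simp)]
      ring
    · rw [Finset.prod_insert (by simp; omega), Finset.prod_insert (by simp; omega),
        Finset.prod_insert (by simp)]
      ring

/-- Iterating the block shift until the first index reaches `0`. -/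
lemma weightedSum_iterate_block {k d : ℕ} : ∀ a c : ℕ, a + 1 + d ≤ k →
    weightedSum k (fun f => X ^ c * (X ^ f (a + 1 + d) - X ^ f a) *
      (∏ j ∈ Finset.Ioo a (a + 1 + d), X ^ f j) *
      (X ^ f (a + 1 + d) * ∏ j ∈ Finset.Ioc (a + 1 + d) k, (X ^ f j) ^ 2)) =
    weightedSum k (fun f => X ^ (c + a) * (1 + X * X ^ f d) *
      (∏ j ∈ Finset.range (d + 1), X ^ f j) * ∏ j ∈ Finset.Ioc d k, (X ^ f j) ^ 2) := by
  intro a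
  induction a with
  | zero =>
    intro c hk
    have h := weightedSum_shift_block (a := 0) (b := 0 + 1 + d) (by omega) hk (fun f => X ^ c *
      (X ^ f (0 + 1 + d) * ∏ j ∈ Finset.Ioc (0 + 1 + d) k, (X ^ f j) ^ 2)) (by
        intro i _ hi f n
        rw [Function.update_of_ne (by omega)]
        congr 2
        refine Finset.prod_congr rfl fun j hj => ?_
        rw [Function.update_of_ne (by simp at hj; omega)])
    have e1 : Finset.Icc 0 (0 + 1 + d) = insert (0 + 1 + d) (Finset.range (d + 1)) := by
      ext; simp; omega
    have e2 : Finset.Ioc d k = insert (0 + 1 + d) (Finset.Ioc (0 + 1 + d) k) := by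
      ext; simp; omega
    convert h using 3 with f f
    · ring
    · rw [e1, e2, Finset.prod_insert (by simp), Finset.prod_insert (by simp),
        show shiftedVar f (0 + 1 + d) = X * X ^ f d by rw [Nat.add_right_comm, zero_add]; rfl,
        show shiftedVar f 0 = -1 from rfl]
      ring
  | succ a ih =>
    intro c hk
    have h := weightedSum_shift_block (a := a + 1) (b := a + 1 + 1 + d) (by omega) hk
      (fun f => X ^ c *
      (X ^ f (a + 1 + 1 + d) * ∏ j ∈ Finset.Ioc (a + 1 + 1 + d) k, (X ^ f j) ^ 2)) (by
        intro i _ hi f n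
        rw [Function.update_of_ne (by omega)]
        congr 2
        refine Finset.prod_congr rfl fun j hj => ?_
        rw [Function.update_of_ne (by simp at hj; omega)])
    have e1 : Finset.Icc (a + 1) (a + 1 + 1 + d) =
        insert (a + 1 + 1 + d) (insert (a + 1 + d) (Finset.Ioo a (a + 1 + d))) := by
      ext; simp; omega
    have e2 : Finset.Ioc (a + 1 + d) k =
        insert (a + 1 + 1 + d) (Finset.Ioc (a + 1 + 1 + d) k) := by
      ext; simp; omega
    rw [show c + (a + 1) = c + 1 + a by ring, ← ih (c + 1) (by omega)]
    convert h using 3 with f f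
    · ring
    · rw [e1, e2, Finset.prod_insert (by simp), Finset.prod_insert (by simp),
        Finset.prod_insert (by simp),
        show shiftedVar f (a + 1 + 1 + d) = X * X ^ f (a + 1 + d) by
          rw [Nat.add_right_comm]; rfl,
        show shiftedVar f (a + 1) = X * X ^ f a from rfl]
      ring

lemma pEval_xv {k j : ℕ} (f : DecTuple k) (hj : 1 ≤ j) :
    pEval k f.1 (xv k j) = X ^ f.1 (j - 1) := by
  unfold pEval xv
  split_ifs with h h0
  · rw [MvPolynomial.aeval_X, if_pos (by simp; omega)]
  · omega
  · rw [map_one, f.2.2 (j - 1) (by omega), pow_zero]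

lemma pEval_qv (k : ℕ) (f : ℕ → ℕ) : pEval k f (qv k) = X := by
  simp [pEval, qv]

/-- Lemma `trans3`:
`(1 - x_s) ∏_{i=s+1}^{k} x_i ≈₂
q^{s-1} (1 + q x_{k-s+1}) (∏_{i=1}^{k-s+1} x_i) (∏_{i=k-s+2}^{k} x_i²)`. -/
theorem stmt15 (k s : ℕ) (hk : 1 ≤ k) (hs1 : 1 ≤ s) (hs2 : s ≤ k) :
    papprox2 k ((1 - xv k s) * ∏ i ∈ Finset.Icc (s + 1) k, xv k i)
      (qv k ^ (s - 1) * (1 + qv k * xv k (k - s + 1)) *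
        (∏ i ∈ Finset.Icc 1 (k - s + 1), xv k i) *
        ∏ i ∈ Finset.Icc (k - s + 2) k, xv k i ^ 2) := by
  obtain ⟨a, rfl⟩ : ∃ a, s = a + 1 := ⟨s - 1, by omega⟩
  obtain ⟨d, rfl⟩ : ∃ d, k = a + 1 + d := ⟨k - (a + 1), by omega⟩
  set k := a + 1 + d with hkd
  have hd : k - (a + 1) = d := by omega
  have hsum := weightedSum_iterate_block (k := k) (d := d) a 0 le_rfl
  have hL : ∀ f : DecTuple k,
      pEval k f.1 ((1 - xv k (a + 1)) * ∏ i ∈ Finset.Icc (a + 1 + 1) k, xv k i) =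
      X ^ 0 * (X ^ f.1 k - X ^ f.1 a) * (∏ j ∈ Finset.Ioo a k, X ^ f.1 j) *
        (X ^ f.1 k * ∏ j ∈ Finset.Ioc k k, (X ^ f.1 j) ^ 2) := by
    intro f
    have hprod : ∏ i ∈ Finset.Icc (a + 1 + 1) k, pEval k f.1 (xv k i) =
        ∏ j ∈ Finset.Ioo a k, X ^ f.1 j := by
      refine Finset.prod_bij' (fun i _ => i - 1) (fun i _ => i + 1) ?_ ?_ ?_ ?_ ?_
      · intro i hi; simp at hi ⊢; omega
      · intro i hi; simp at hi ⊢; omega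
      · intro i hi; simp at hi ⊢; omega
      · intro i hi; simp
      · intro i hi; simp at hi; exact pEval_xv f (by omega)
    have hx := pEval_xv f (show 1 ≤ a + 1 by omega)
    unfold pEval at hprod hx ⊢
    rw [map_mul, map_prod, map_sub, map_one, hprod, hx, f.2.2 k le_rfl]
    simp
  have hR : ∀ f : DecTuple k,
      pEval k f.1 (qv k ^ (a + 1 - 1) * (1 + qv k * xv k (k - (a + 1) + 1)) *
        (∏ i ∈ Finset.Icc 1 (k - (a + 1) + 1), xv k i) *
        ∏ i ∈ Finset.Icc (k - (a + 1) + 2) k, xv k i ^ 2) =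
      X ^ (0 + a) * (1 + X * X ^ f.1 d) *
        (∏ j ∈ Finset.range (d + 1), X ^ f.1 j) * ∏ j ∈ Finset.Ioc d k, (X ^ f.1 j) ^ 2 := by
    intro f
    rw [hd]
    have hp1 : ∏ i ∈ Finset.Icc 1 (d + 1), pEval k f.1 (xv k i) =
        ∏ j ∈ Finset.range (d + 1), X ^ f.1 j := by
      refine Finset.prod_bij' (fun i _ => i - 1) (fun i _ => i + 1) ?_ ?_ ?_ ?_ ?_
      · intro i hi; simp at hi ⊢; omega
      · intro i hi; simp at hi ⊢; omega
      · intro i hi; simp at hi ⊢; omega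
      · intro i hi; simp
      · intro i hi; simp at hi; exact pEval_xv f (by omega)
    have hp2 : ∏ i ∈ Finset.Icc (d + 2) k, pEval k f.1 (xv k i) ^ 2 =
        ∏ j ∈ Finset.Ioc d k, (X ^ f.1 j) ^ 2 := by
      rw [show Finset.Ioc d k = insert k (Finset.Ioo d k) by ext; simp; omega,
        Finset.prod_insert (by simp), f.2.2 k le_rfl, pow_zero, one_pow, one_mul]
      refine Finset.prod_bij' (fun i _ => i - 1) (fun i _ => i + 1) ?_ ?_ ?_ ?_ ?_
      · intro i hi; simp at hi ⊢; omega
      · intro i hi; simp at hi ⊢; omega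
      · intro i hi; simp at hi ⊢; omega
      · intro i hi; simp
      · intro i hi; simp at hi; rw [pEval_xv f (by omega)]
    have hx := pEval_xv f (show 1 ≤ d + 1 by omega)
    have hq := pEval_qv k f.1
    unfold pEval at hp1 hp2 hx hq ⊢
    simp only [map_mul, map_prod, map_add, map_pow, map_one, hp1, hp2, hx, hq]
    simp
  refine Eq.trans ?_ ((weightedSum_sub k _ _).trans (sub_eq_zero.2 hsum))
  exact tsum_congr fun f => congrArg (tupleWeight k f.1 * ·) (congrArg₂ (· - ·) (hL f) (hR f))
end
end
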